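/- Witness bound for the R_y family: the Hermitian operator H = Z⊗I + X⊗X satisfies |Tr(H·σ)| ≤ 1 for every pure two-qubit stabilizer state σ ∈ Stab₂, and the maximum value max_{σ ∈ Stab₂} Tr(H·σ) = 1 is attained (for instance at the Bell state (1/√2)(|00⟩ + |11⟩)). -/

import Mathlib

open Matrix Kronecker Finset
open scoped ComplexOrder

noncomputable section

def PX : Matrix (Fin 2) (Fin 2) ℂ := !![0, 1; 1, 0]
def PY : Matrix (Fin 2) (Fin 2) ℂ := !![0, -Complex.I; Complex.I, 0]
def PZ : Matrix (Fin 2) (Fin 2) ℂ := !![1, 0; 0, -1]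

/-- The single-qubit phase-point operator `A_{(q,p)}`. -/
def A1 (a : ZMod 2 × ZMod 2) : Matrix (Fin 2) (Fin 2) ℂ :=
  (1 / 2 : ℂ) • ((1 : Matrix (Fin 2) (Fin 2) ℂ)
    + ((-1 : ℂ) ^ a.2.val) • PX
    + ((-1 : ℂ) ^ (a.1.val + a.2.val)) • PY
    + ((-1 : ℂ) ^ a.1.val) • PZ)

def pauli : Fin 4 → Matrix (Fin 2) (Fin 2) ℂ := ![1, PX, PY, PZ]

/-- A density matrix: positive semidefinite with unit trace. -/
def IsDensity {d : ℕ} (ρ : Matrix (Fin d) (Fin d) ℂ) : Prop :=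
  ρ.PosSemidef ∧ ρ.trace = 1

/-- Kronecker product of 2×2 matrices as a 4×4 matrix. -/
def kron2 (M N : Matrix (Fin 2) (Fin 2) ℂ) : Matrix (Fin 4) (Fin 4) ℂ :=
  Matrix.reindex (finProdFinEquiv.trans (finCongr (by norm_num)))
    (finProdFinEquiv.trans (finCongr (by norm_num))) (M ⊗ₖ N)

/-- The two-qubit phase-point operator `A_α = A_{α₁} ⊗ A_{α₂}`. -/
def A2 (α : (ZMod 2 × ZMod 2) × (ZMod 2 × ZMod 2)) : Matrix (Fin 4) (Fin 4) ℂ :=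
  kron2 (A1 α.1) (A1 α.2)

/-- The two-qubit Pauli group `P₂`. -/
def Pauli2 : Set (Matrix (Fin 4) (Fin 4) ℂ) :=
  { M | ∃ (k : Fin 4) (P Q : Fin 4), M = Complex.I ^ (k : ℕ) • kron2 (pauli P) (pauli Q) }

/-- `S` is an abelian subgroup of `P₂` with `|S| = 4` and `-I ∉ S`. -/
def IsStabGroup2 (S : Finset (Matrix (Fin 4) (Fin 4) ℂ)) : Prop :=
  (∀ g ∈ S, g ∈ Pauli2) ∧ (1 : Matrix (Fin 4) (Fin 4) ℂ) ∈ S ∧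
  (∀ g ∈ S, ∀ h ∈ S, g * h ∈ S ∧ g * h = h * g) ∧
  S.card = 4 ∧ (-1 : Matrix (Fin 4) (Fin 4) ℂ) ∉ S

/-- The pure two-qubit stabilizer states. -/
def Stab2 : Set (Matrix (Fin 4) (Fin 4) ℂ) :=
  { σ | ∃ S : Finset (Matrix (Fin 4) (Fin 4) ℂ),
      IsStabGroup2 S ∧ σ = (4 : ℂ)⁻¹ • ∑ g ∈ S, g }

/-- Two-qubit discrete Wigner function (of any 4×4 matrix). -/
def W2 (ρ : Matrix (Fin 4) (Fin 4) ℂ) (α : (ZMod 2 × ZMod 2) × (ZMod 2 × ZMod 2)) : ℝ :=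
  ((4 : ℂ)⁻¹ * (ρ * A2 α).trace).re

/-- Two-qubit free Wigner polytope. -/
def WFree2 : Set (((ZMod 2 × ZMod 2) × (ZMod 2 × ZMod 2)) → ℝ) :=
  convexHull ℝ { w | ∃ σ ∈ Stab2, w = W2 σ }

/-- Two-qubit Wigner distance `C(ρ)`. -/
def C2 (ρ : Matrix (Fin 4) (Fin 4) ℂ) : ℝ :=
  sInf { d | ∃ f ∈ WFree2, d = ∑ α, |W2 ρ α - f α| }

/-- Two-qubit stabilizer extent `Γ(ρ)`. -/
def Gam2 (ρ : Matrix (Fin 4) (Fin 4) ℂ) : ℝ :=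
  sInf { t | ∃ (k : ℕ) (a : Fin k → ℝ) (s : Fin k → Matrix (Fin 4) (Fin 4) ℂ),
      (∀ i, s i ∈ Stab2) ∧ ρ = ∑ i, a i • s i ∧ t = ∑ i, |a i| }

/-- Rank-one projection `|ψ⟩⟨ψ|`. -/
def proj (ψ : Fin 4 → ℂ) : Matrix (Fin 4) (Fin 4) ℂ :=
  Matrix.vecMulVec ψ fun j => (starRingEnd ℂ) (ψ j)

/-- The basis vector `|00⟩`. -/
def e0 : Fin 4 → ℂ := fun i => if i = 0 then 1 else 0

/-- The basis vector `|11⟩`. -/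
def e3 : Fin 4 → ℂ := fun i => if i = 3 then 1 else 0

/-- `|ψ_θ⟩ = cos(θ/2)|00⟩ + sin(θ/2)|11⟩` (the R_y family). -/
def psiRy (θ : ℝ) : Fin 4 → ℂ := fun i =>
  if i = 0 then ((Real.cos (θ / 2) : ℝ) : ℂ)
  else if i = 3 then ((Real.sin (θ / 2) : ℝ) : ℂ) else 0

/-- `|ψ_θ⟩ = cos(θ/2)|00⟩ − i sin(θ/2)|11⟩` (the R_x family). -/
def psiRx (θ : ℝ) : Fin 4 → ℂ := fun i =>
  if i = 0 then ((Real.cos (θ / 2) : ℝ) : ℂ)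
  else if i = 3 then -Complex.I * ((Real.sin (θ / 2) : ℝ) : ℂ) else 0

/-- `|Φ_θ⟩ = (1/√2)(|00⟩ + e^{iθ}|11⟩)` (the Bell+R_z family). -/
def psiB (θ : ℝ) : Fin 4 → ℂ := fun i =>
  if i = 0 then (((Real.sqrt 2 : ℝ) : ℂ))⁻¹
  else if i = 3 then Complex.exp (θ * Complex.I) / ((Real.sqrt 2 : ℝ) : ℂ) else 0

/-- `|+_L⟩ = (1/√2)(|00⟩ + |11⟩)`. -/
def pPlus : Fin 4 → ℂ := fun i =>
  if i = 0 then (((Real.sqrt 2 : ℝ) : ℂ))⁻¹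
  else if i = 3 then (((Real.sqrt 2 : ℝ) : ℂ))⁻¹ else 0

/-- `|−_L⟩ = (1/√2)(|00⟩ − |11⟩)`. -/
def pMinus : Fin 4 → ℂ := fun i =>
  if i = 0 then (((Real.sqrt 2 : ℝ) : ℂ))⁻¹
  else if i = 3 then -(((Real.sqrt 2 : ℝ) : ℂ))⁻¹ else 0

lemma kron2_mul (M N M' N' : Matrix (Fin 2) (Fin 2) ℂ) :
    kron2 M N * kron2 M' N' = kron2 (M * M') (N * N') := by
  simp only [kron2, Matrix.reindex_apply, Matrix.submatrix_mul_equiv, Matrix.mul_kronecker_mul]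

lemma kron2_one : kron2 1 1 = 1 := by
  simp [kron2]

lemma trace_kron2 (M N : Matrix (Fin 2) (Fin 2) ℂ) :
    (kron2 M N).trace = M.trace * N.trace := by
  rw [← Matrix.trace_kronecker]
  simp only [kron2, Matrix.trace, Matrix.reindex_apply, Matrix.diag_apply,
    Matrix.submatrix_apply]
  exact Equiv.sum_comp _ fun i => (M ⊗ₖ N) i i

lemma kron2_of (a b c d e f g h : ℂ) :
    kron2 !![a, b; c, d] !![e, f; g, h] =
      !![a * e, a * f, b * e, b * f; a * g, a * h, b * g, b * h;
         c * e, c * f, d * e, d * f; c * g, c * h, d * g, d * h] := by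
  ext i j
  fin_cases i <;> fin_cases j <;> rfl

lemma pauli_mul_self (i : Fin 4) : pauli i * pauli i = 1 := by
  fin_cases i <;> simp [pauli, PX, PY, PZ, Matrix.one_fin_two]

lemma trace_pauli_mul (i j : Fin 4) :
    (pauli i * pauli j).trace = if i = j then 2 else 0 := by
  fin_cases i <;> fin_cases j <;>
    simp [pauli, PX, PY, PZ, Matrix.trace_fin_two, Matrix.one_fin_two] <;> norm_num

lemma kron2_pauli_mul_self (i j : Fin 4) :
    kron2 (pauli i) (pauli j) * kron2 (pauli i) (pauli j) = 1 := by
  rw [kron2_mul, pauli_mul_self, pauli_mul_self, kron2_one]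

lemma trace_kron2_pauli_mul (i j k l : Fin 4) :
    (kron2 (pauli i) (pauli j) * kron2 (pauli k) (pauli l)).trace =
      if i = k ∧ j = l then 4 else 0 := by
  rw [kron2_mul, trace_kron2, trace_pauli_mul, trace_pauli_mul]
  by_cases hik : i = k <;> by_cases hjl : j = l <;> simp [hik, hjl]
  norm_num

lemma kron2_PZ_one : kron2 PZ 1 = kron2 (pauli 3) (pauli 0) := rfl

lemma kron2_PX_PX : kron2 PX PX = kron2 (pauli 1) (pauli 1) := rfl

lemma PX_mul_PZ : PX * PZ = -(PZ * PX) := by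
  simp [PX, PZ]

lemma kron2_PX_PX_mul_kron2_PZ_one :
    kron2 PX PX * kron2 PZ 1 = -(kron2 PZ 1 * kron2 PX PX) := by
  rw [kron2_mul, kron2_mul, PX_mul_PZ]
  ext i j
  simp [kron2, Matrix.kroneckerMap_apply]

/-- A Pauli element overlapping with `Z ⊗ I + X ⊗ X` is a phase times one of its two terms. -/
lemma eq_smul_of_trace_witness_ne_zero {g : Matrix (Fin 4) (Fin 4) ℂ} (hg : g ∈ Pauli2)
    (h : ((kron2 PZ 1 + kron2 PX PX) * g).trace ≠ 0) :
    ‖((kron2 PZ 1 + kron2 PX PX) * g).trace‖ = 4 ∧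
      ∃ c : ℂ, c ^ 4 = 1 ∧ (g = c • kron2 PZ 1 ∨ g = c • kron2 PX PX) := by
  obtain ⟨k, P, Q, rfl⟩ := hg
  have hc : (Complex.I ^ (k : ℕ)) ^ 4 = 1 := by rw [← pow_mul, mul_comm, pow_mul]; simp
  rw [kron2_PZ_one, kron2_PX_PX] at *
  simp only [Matrix.mul_smul, Matrix.trace_smul, add_mul, Matrix.trace_add,
    trace_kron2_pauli_mul] at h ⊢
  by_cases h₁ : 3 = P ∧ 0 = Q
  · obtain ⟨rfl, rfl⟩ := h₁
    exact ⟨by simp, _, hc, Or.inl rfl⟩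
  by_cases h₂ : 1 = P ∧ 1 = Q
  · obtain ⟨rfl, rfl⟩ := h₂
    exact ⟨by simp, _, hc, Or.inr rfl⟩
  simp [h₁, h₂] at h

namespace IsStabGroup2

variable {S : Finset (Matrix (Fin 4) (Fin 4) ℂ)}

/-- A stabilizer group contains at most one phase multiple of each involution. -/
lemma smul_unique (hS : IsStabGroup2 S) {A : Matrix (Fin 4) (Fin 4) ℂ} (hA : A * A = 1)
    {c d : ℂ} (hc : c ^ 4 = 1) (hd : d ^ 4 = 1) (hcS : c • A ∈ S) (hdS : d • A ∈ S) :
    c = d := by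
  obtain ⟨-, -, hmul, -, hneg⟩ := hS
  have ne (x y : ℂ) (hx : x • A ∈ S) (hy : y • A ∈ S) : x * y ≠ -1 := by
    intro hxy
    have := (hmul _ hx _ hy).1
    rw [smul_mul_smul_comm, hA, hxy, neg_one_smul] at this
    exact hneg this
  have sq (x : ℂ) (hx : x ^ 4 = 1) (hxS : x • A ∈ S) : x = 1 ∨ x = -1 := by
    rw [← sq_eq_one_iff]
    have : (x ^ 2) ^ 2 = 1 := by rw [← pow_mul]; exact hx
    exact (sq_eq_one_iff.mp this).resolve_right (by rw [pow_two]; exact ne _ _ hxS hxS)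
  have hcd := ne c d hcS hdS
  rcases sq c hc hcS with rfl | rfl <;> rcases sq d hd hdS with rfl | rfl <;> simp_all

/-- A stabilizer group does not contain phase multiples of two anticommuting involutions. -/
lemma not_mem_of_anticommute (hS : IsStabGroup2 S) {A B : Matrix (Fin 4) (Fin 4) ℂ}
    (hA : A * A = 1) (hB : B * B = 1) (hAB : B * A = -(A * B)) {c d : ℂ} (hc : c ≠ 0)
    (hd : d ≠ 0) (hcS : c • A ∈ S) : d • B ∉ S := by
  intro hdS
  have h := (hS.2.2.1 _ hcS _ hdS).2
  rw [smul_mul_smul_comm, smul_mul_smul_comm, hAB, mul_comm d c, smul_neg,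
    eq_neg_iff_add_eq_zero, ← two_smul ℂ, smul_eq_zero, smul_eq_zero] at h
  have h0 : A * B = 0 :=
    (h.resolve_left two_ne_zero).resolve_left (mul_ne_zero hc hd)
  have : A * (A * B) * B = 1 := by rw [← mul_assoc, hA, one_mul, hB]
  simp [h0] at this

lemma eq_of_trace_witness_ne_zero (hS : IsStabGroup2 S) {g h : Matrix (Fin 4) (Fin 4) ℂ}
    (hg : g ∈ S) (hh : h ∈ S) (hg0 : ((kron2 PZ 1 + kron2 PX PX) * g).trace ≠ 0)
    (hh0 : ((kron2 PZ 1 + kron2 PX PX) * h).trace ≠ 0) : g = h := by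
  have hA : kron2 PZ 1 * kron2 PZ 1 = 1 := kron2_pauli_mul_self 3 0
  have hB : kron2 PX PX * kron2 PX PX = 1 := kron2_pauli_mul_self 1 1
  have hAB := kron2_PX_PX_mul_kron2_PZ_one
  have ne {x : ℂ} (hx : x ^ 4 = 1) : x ≠ 0 := by rintro rfl; simp at hx
  obtain ⟨-, c, hc, h₁⟩ := eq_smul_of_trace_witness_ne_zero (hS.1 g hg) hg0
  obtain ⟨-, d, hd, h₂⟩ := eq_smul_of_trace_witness_ne_zero (hS.1 h hh) hh0
  rcases h₁ with rfl | rfl <;> rcases h₂ with rfl | rfl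
  · rw [hS.smul_unique hA hc hd hg hh]
  · exact absurd hh (hS.not_mem_of_anticommute hA hB hAB (ne hc) (ne hd) hg)
  · exact absurd hg (hS.not_mem_of_anticommute hA hB hAB (ne hd) (ne hc) hh)
  · rw [hS.smul_unique hB hc hd hg hh]

end IsStabGroup2

open scoped Classical in
/-- Two commuting traceless involutions with traceless product stabilize a pure state. -/
lemma mem_Stab2_of_involutions {a b : Matrix (Fin 4) (Fin 4) ℂ} (ha : a ∈ Pauli2)
    (hb : b ∈ Pauli2) (hab : a * b ∈ Pauli2) (haa : a * a = 1) (hbb : b * b = 1)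
    (hcomm : a * b = b * a) (hta : a.trace = 0) (htb : b.trace = 0)
    (htab : (a * b).trace = 0) :
    (4 : ℂ)⁻¹ • (1 + a + b + a * b) ∈ Stab2 := by
  have ht1 : (1 : Matrix (Fin 4) (Fin 4) ℂ).trace = 4 := by simp
  have ne {x : Matrix (Fin 4) (Fin 4) ℂ} (hx : x.trace = 0) : (1 : Matrix _ _ ℂ) ≠ x := by
    rintro rfl; simp [hx] at ht1
  have ne' {x : Matrix (Fin 4) (Fin 4) ℂ} (hx : x.trace = 0) : (-1 : Matrix _ _ ℂ) ≠ x := by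
    rintro rfl; simp at hx
  have h1 : a ≠ b := by
    rintro rfl; exact ne htab haa.symm
  have h2 : a ≠ a * b := fun h => ne htb (by
    nth_rw 1 [← haa, h]; rw [hcomm, mul_assoc, haa, mul_one])
  have h3 : b ≠ a * b := fun h => ne hta (by
    rw [← hbb]; nth_rw 1 [h]; rw [mul_assoc, hbb, mul_one])
  have hba : b * (a * b) = a := by rw [hcomm, ← mul_assoc, hbb, one_mul]
  have hab' : a * (a * b) = b := by rw [← mul_assoc, haa, one_mul]
  have hba' : a * b * a = b := by rw [hcomm, mul_assoc, haa, mul_one]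
  have hab'' : a * b * b = a := by rw [mul_assoc, hbb, mul_one]
  have habab : a * b * (a * b) = 1 := by rw [mul_assoc, hba, haa]
  refine ⟨{1, a, b, a * b}, ⟨?_, by simp, ?_, ?_, ?_⟩, ?_⟩
  · simpa [ha, hb, hab] using ⟨0, 0, 0, by simpa [pauli] using kron2_one.symm⟩
  · simp only [Finset.mem_insert, Finset.mem_singleton]
    rintro g (rfl | rfl | rfl | rfl) h (rfl | rfl | rfl | rfl) <;>
      simp [haa, hbb, hba, hab', hba', hab'', habab, ← hcomm]
  · simp [ne hta, ne htb, ne htab, h1, h2, h3]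
  · simp [ne' hta, ne' htb, ne' htab, ne_of_apply_ne Matrix.trace, CharZero.neg_eq_self_iff]
  · simp [ne hta, ne htb, ne htab, h1, h2, h3, add_assoc]

lemma norm_trace_witness_mul_le_one {σ : Matrix (Fin 4) (Fin 4) ℂ} (hσ : σ ∈ Stab2) :
    ‖((kron2 PZ 1 + kron2 PX PX) * σ).trace‖ ≤ 1 := by
  obtain ⟨S, hS, rfl⟩ := hσ
  rw [Matrix.mul_smul, Matrix.trace_smul, Finset.mul_sum, Matrix.trace_sum, norm_smul]
  by_cases h : ∃ g ∈ S, ((kron2 PZ 1 + kron2 PX PX) * g).trace ≠ 0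
  · obtain ⟨g, hg, hg0⟩ := h
    rw [Finset.sum_eq_single_of_mem g hg fun k hk hkg => by
        by_contra hk0
        exact hkg (hS.eq_of_trace_witness_ne_zero hk hg hk0 hg0),
      (eq_smul_of_trace_witness_ne_zero (hS.1 g hg) hg0).1]
    norm_num
  · push Not at h
    simp [Finset.sum_eq_zero h]

lemma proj_pPlus :
    proj pPlus = (2 : ℂ)⁻¹ • !![1, 0, 0, 1; 0, 0, 0, 0; 0, 0, 0, 0; 1, 0, 0, 1] := by
  have hsqrt : ((Real.sqrt 2 : ℝ) : ℂ)⁻¹ * ((Real.sqrt 2 : ℝ) : ℂ)⁻¹ = 2⁻¹ := by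
    rw [← mul_inv, ← Complex.ofReal_mul, Real.mul_self_sqrt zero_le_two, Complex.ofReal_ofNat]
  ext i j
  fin_cases i <;> fin_cases j <;>
    simp [proj, pPlus, Matrix.vecMulVec_apply, hsqrt]

lemma proj_pPlus_mem_Stab2 : proj pPlus ∈ Stab2 := by
  have hmul : kron2 PX PX * kron2 PZ PZ = Complex.I ^ 2 • kron2 PY PY := by
    simp [PX, PY, PZ, kron2_of]
  have heq : proj pPlus =
      (4 : ℂ)⁻¹ • (1 + kron2 PX PX + kron2 PZ PZ + kron2 PX PX * kron2 PZ PZ) := by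
    rw [proj_pPlus, ← kron2_one]
    simp [PX, PZ, Matrix.one_fin_two, kron2_of]
    norm_num
  rw [heq]
  refine mem_Stab2_of_involutions ⟨0, 1, 1, by simp [pauli]⟩ ⟨0, 3, 3, by simp [pauli]⟩
    ⟨2, 2, 2, by simpa [pauli] using hmul⟩ (kron2_pauli_mul_self 1 1)
    (kron2_pauli_mul_self 3 3) ?_ ?_ ?_ ?_ <;>
  simp [PX, PZ, kron2_of, Matrix.trace, Fin.sum_univ_succ]

/-- witness bound for the R_y family: `H = Z⊗I + X⊗X` has
`|Tr(Hσ)| ≤ 1` on all stabilizer states, with maximum value 1 attained,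
for instance at the Bell state `(1/√2)(|00⟩+|11⟩)`. -/
theorem witness_Ry :
    (∀ σ ∈ Stab2, ‖((kron2 PZ 1 + kron2 PX PX) * σ).trace‖ ≤ 1) ∧
    IsGreatest { v | ∃ σ ∈ Stab2, v = (((kron2 PZ 1 + kron2 PX PX) * σ).trace).re } 1 ∧
    proj pPlus ∈ Stab2 ∧
    (((kron2 PZ 1 + kron2 PX PX) * proj pPlus).trace).re = 1 := by
  have hbell : (((kron2 PZ 1 + kron2 PX PX) * proj pPlus).trace).re = 1 := by
    rw [proj_pPlus]
    simp [PX, PZ, Matrix.one_fin_two, kron2_of, Matrix.trace, Fin.sum_univ_succ]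
    norm_num
  refine ⟨fun σ hσ => norm_trace_witness_mul_le_one hσ,
    ⟨⟨_, proj_pPlus_mem_Stab2, hbell.symm⟩, ?_⟩, proj_pPlus_mem_Stab2, hbell⟩
  rintro _ ⟨σ, hσ, rfl⟩
  exact (Complex.re_le_norm _).trans (norm_trace_witness_mul_le_one hσ)
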